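/- For every positive integer n and every natural number k, the number of permutations of {1,…,n} having exactly k cycle peaks equals the number of permutations of {1,…,n} having exactly k left peaks. -/

import Mathlib

/-- The extended one-line word of `τ ∈ 𝔖ₙ` with values in `{1, …, n}` (`1`-based
positions) and the conventions `τ₀ = 0` and `τ_{n+1} = n+1`. -/
def permVal (n : ℕ) (τ : Equiv.Perm (Fin n)) (k : ℕ) : ℕ :=
  if h : 1 ≤ k ∧ k ≤ n then (τ ⟨k - 1, by omega⟩ : ℕ) + 1
  else if k = 0 then 0 else n + 1

/-- The number of left peaks of `τ`: positions `i ∈ {1, …, n}` with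
`τ_{i-1} < τ_i > τ_{i+1}`, using the conventions `τ₀ = 0` and `τ_{n+1} = n+1`. -/
def lpk (n : ℕ) (τ : Equiv.Perm (Fin n)) : ℕ :=
  ((Finset.Icc 1 n).filter (fun i =>
    permVal n τ (i - 1) < permVal n τ i ∧ permVal n τ (i + 1) < permVal n τ i)).card

/-- The number of cycle peaks of `τ`: letters `k` with `τ⁻¹(k) < k` and `τ(k) < k`
(here `0`-indexed; the condition `τ⁻¹ k < k` automatically excludes the smallest letter). -/
def cpk (n : ℕ) (τ : Equiv.Perm (Fin n)) : ℕ :=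
  (Finset.univ.filter (fun k : Fin n => τ⁻¹ k < k ∧ τ k < k)).card

open Finset Equiv

/-- The positions (shifted to start at `0`) of the left peaks of `τ`. -/
def leftPeaks (n : ℕ) (τ : Perm (Fin n)) : Finset (Fin n) :=
  univ.filter fun i =>
    permVal n τ i < permVal n τ (i + 1) ∧ permVal n τ (i + 2) < permVal n τ (i + 1)

/-- The cycle peaks of `τ`. -/
def cyclePeaks (n : ℕ) (τ : Perm (Fin n)) : Finset (Fin n) :=
  univ.filter fun k => τ⁻¹ k < k ∧ τ k < k

theorem card_leftPeaks (n : ℕ) (τ : Perm (Fin n)) : (leftPeaks n τ).card = lpk n τ := by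
  refine card_bij (fun i _ => (i : ℕ) + 1) ?_ ?_ ?_
  · intro i hi
    have := i.isLt
    simp only [leftPeaks, mem_filter, mem_univ, true_and, mem_Icc] at hi ⊢
    exact ⟨by omega, hi⟩
  · intro i _ j _ h
    exact Fin.ext (by simpa using h)
  · intro m hm
    simp only [mem_filter, mem_Icc] at hm
    obtain ⟨m, rfl⟩ : ∃ l, m = l + 1 := ⟨m - 1, by omega⟩
    exact ⟨⟨m, by omega⟩, by simpa [leftPeaks] using hm.2, rfl⟩

/-- If `P` and its preimage under `e` are disjoint and `q` drops by one from `#P + 1` exactly on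
their union, then `q` takes the value `#P` exactly `2 * #P` times. -/
theorem sum_comp_of_add_indicators {α : Type*} [Fintype α] [DecidableEq α] (P : Finset α)
    (e : Perm α) (hP : ∀ k, k ∈ P → e k ∉ P) (q : α → ℕ)
    (hq : ∀ k, q k = (P \ {k, e k}).card + 1) (G : ℕ → ℕ) :
    ∑ k, G (q k) = 2 * P.card * G P.card + (Fintype.card α - 2 * P.card) * G (P.card + 1) := by
  set U := P ∪ P.map e.symm.toEmbedding with hU
  have memU : ∀ k, k ∈ U ↔ k ∈ P ∨ e k ∈ P := by
    intro k
    simp [hU]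
  have cardU : U.card = 2 * P.card := by
    rw [hU, card_union_of_disjoint, card_map, two_mul]
    rw [disjoint_left]
    intro k hk hk'
    rw [mem_map_equiv] at hk'
    exact hP k hk (by simpa using hk')
  have hval : ∀ k, G (q k) = if k ∈ U then G P.card else G (P.card + 1) := by
    intro k
    rw [hq]
    by_cases h1 : k ∈ P
    · have h2 := hP k h1
      have : P \ {k, e k} = P.erase k := by
        ext x
        simp only [mem_sdiff, mem_insert, mem_singleton, mem_erase]
        grind
      rw [this, card_erase_add_one h1, if_pos ((memU k).2 (Or.inl h1))]
    · by_cases h2 : e k ∈ P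
      · have : P \ {k, e k} = P.erase (e k) := by
          ext x
          simp only [mem_sdiff, mem_insert, mem_singleton, mem_erase]
          grind
        rw [this, card_erase_add_one h2, if_pos ((memU k).2 (Or.inr h2))]
      · have : P \ {k, e k} = P := by
          ext x
          simp only [mem_sdiff, mem_insert, mem_singleton]
          grind
        rw [this, if_neg (by rw [memU]; tauto)]
  simp_rw [hval]
  rw [sum_ite, sum_const, sum_const, filter_mem_eq_inter, univ_inter, ← compl_filter,
    filter_mem_eq_inter, univ_inter, card_compl, cardU, smul_eq_mul, smul_eq_mul]

/-- Permutations of `Fin (n + 1)` obtained by inserting the largest letter into the cycles of a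
permutation of `Fin n`, either as a fixed point or right before a given letter. -/
def cycleInsert (n : ℕ) : Option (Fin n) × Perm (Fin n) ≃ Perm (Fin (n + 1)) :=
  Perm.decomposeOption.symm.trans finSuccEquivLast.symm.permCongr

theorem cycleInsert_none_castSucc {n : ℕ} (σ : Perm (Fin n)) (x : Fin n) :
    cycleInsert n (none, σ) x.castSucc = (σ x).castSucc := by
  simp [cycleInsert]

theorem cycleInsert_none_last {n : ℕ} (σ : Perm (Fin n)) :
    cycleInsert n (none, σ) (Fin.last n) = Fin.last n := by
  simp [cycleInsert]

theorem cycleInsert_some_castSucc {n : ℕ} (k : Fin n) (σ : Perm (Fin n)) (x : Fin n) :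
    cycleInsert n (some k, σ) x.castSucc = if σ x = k then Fin.last n else (σ x).castSucc := by
  split_ifs with h
  · simp [cycleInsert, h]
  · simp [cycleInsert, swap_apply_of_ne_of_ne, h]

theorem cycleInsert_some_last {n : ℕ} (k : Fin n) (σ : Perm (Fin n)) :
    cycleInsert n (some k, σ) (Fin.last n) = k.castSucc := by
  simp [cycleInsert]

theorem cyclePeaks_cycleInsert_none {n : ℕ} (σ : Perm (Fin n)) :
    cyclePeaks (n + 1) (cycleInsert n (none, σ)) = (cyclePeaks n σ).map Fin.castSuccEmb := by
  have hinv : ∀ x : Fin n, (cycleInsert n (none, σ))⁻¹ x.castSucc = (σ⁻¹ x).castSucc := by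
    intro x
    rw [Perm.inv_eq_iff_eq, cycleInsert_none_castSucc, Perm.inv_def, apply_symm_apply]
  ext a
  refine Fin.lastCases ?_ (fun x => ?_) a
  · simp [cyclePeaks, cycleInsert_none_last, Fin.castSucc_ne_last]
  · rw [← Fin.coe_castSuccEmb, mem_map' Fin.castSuccEmb]
    simp only [cyclePeaks, mem_filter, mem_univ, true_and, Fin.coe_castSuccEmb, hinv,
      cycleInsert_none_castSucc, Fin.castSucc_lt_castSucc_iff]

theorem cyclePeaks_cycleInsert_some {n : ℕ} (k : Fin n) (σ : Perm (Fin n)) :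
    cyclePeaks (n + 1) (cycleInsert n (some k, σ)) =
      insert (Fin.last n) ((cyclePeaks n σ \ {k, σ⁻¹ k}).map Fin.castSuccEmb) := by
  have hinv : ∀ x : Fin n, (cycleInsert n (some k, σ))⁻¹ x.castSucc =
      if x = k then Fin.last n else (σ⁻¹ x).castSucc := by
    intro x
    rw [Perm.inv_eq_iff_eq]
    split_ifs with h
    · rw [cycleInsert_some_last, h]
    · rw [cycleInsert_some_castSucc, Perm.inv_def, apply_symm_apply, if_neg h]
  have hinv' : (cycleInsert n (some k, σ))⁻¹ (Fin.last n) = (σ⁻¹ k).castSucc := by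
    rw [Perm.inv_eq_iff_eq, cycleInsert_some_castSucc, Perm.inv_def, apply_symm_apply, if_pos rfl]
  ext a
  refine Fin.lastCases ?_ (fun x => ?_) a
  · simp only [cyclePeaks, mem_filter, mem_univ, true_and, hinv', cycleInsert_some_last,
      mem_insert, true_or, iff_true]
    exact ⟨Fin.castSucc_lt_last _, Fin.castSucc_lt_last _⟩
  · have hx : x = σ⁻¹ k ↔ σ x = k := by rw [eq_comm, Perm.inv_eq_iff_eq, eq_comm]
    have hl : ¬ Fin.last n < x.castSucc := not_lt.2 (Fin.le_last _)
    rw [mem_insert, ← Fin.coe_castSuccEmb, mem_map' Fin.castSuccEmb]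
    simp only [cyclePeaks, mem_filter, mem_univ, true_and, Fin.coe_castSuccEmb, hinv,
      cycleInsert_some_castSucc, Fin.castSucc_ne_last, false_or, mem_sdiff, mem_insert,
      mem_singleton, hx]
    split_ifs <;> simp_all

theorem sum_cpk_succ (n : ℕ) (G : ℕ → ℕ) :
    ∑ τ : Perm (Fin (n + 1)), G (cpk (n + 1) τ) =
      ∑ σ : Perm (Fin n), (G (cpk n σ) + (2 * cpk n σ * G (cpk n σ) +
        (n - 2 * cpk n σ) * G (cpk n σ + 1))) := by
  rw [← (cycleInsert n).sum_comp, Fintype.sum_prod_type_right]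
  refine sum_congr rfl fun σ _ => ?_
  rw [Fintype.sum_option]
  congr 1
  · change G (cyclePeaks (n + 1) _).card = G (cyclePeaks n σ).card
    rw [cyclePeaks_cycleInsert_none, card_map]
  · refine (sum_comp_of_add_indicators (cyclePeaks n σ) σ⁻¹ ?_ _ ?_ G).trans ?_
    · intro k h h'
      simp only [cyclePeaks, mem_filter, mem_univ, true_and, Perm.inv_def, apply_symm_apply] at h h'
      exact lt_asymm h.1 h'.2
    · intro k
      change (cyclePeaks (n + 1) _).card = _
      rw [cyclePeaks_cycleInsert_some, card_insert_of_notMem, card_map]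
      simp [Fin.castSucc_ne_last]
    · rw [Fintype.card_fin]; rfl

/-- The permutation of `Fin (n + 1)` whose word is that of `σ` with the largest letter inserted
at position `j`. -/
def wordInsert {n : ℕ} (j : Fin (n + 1)) (σ : Perm (Fin n)) : Perm (Fin (n + 1)) :=
  (finSuccEquiv' j).trans ((optionCongr σ).trans finSuccEquivLast.symm)

theorem wordInsert_self {n : ℕ} (j : Fin (n + 1)) (σ : Perm (Fin n)) :
    wordInsert j σ j = Fin.last n := by
  simp [wordInsert]

theorem wordInsert_succAbove {n : ℕ} (j : Fin (n + 1)) (σ : Perm (Fin n)) (x : Fin n) :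
    wordInsert j σ (j.succAbove x) = (σ x).castSucc := by
  simp [wordInsert]

theorem wordInsert_bijective (n : ℕ) :
    Function.Bijective fun p : Fin (n + 1) × Perm (Fin n) => wordInsert p.1 p.2 := by
  rw [Fintype.bijective_iff_injective_and_card]
  constructor
  · rintro ⟨j, σ⟩ ⟨j', σ'⟩ h
    simp only at h
    have hj : j = j' := by
      apply (wordInsert j σ).injective
      rw [wordInsert_self, h, wordInsert_self]
    subst hj
    congr 1
    ext x
    have := congrArg (fun τ => τ (j.succAbove x)) h
    simp only [wordInsert_succAbove] at this
    rw [Fin.castSucc_injective n this]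
  · simp [Fintype.card_perm, Nat.factorial_succ]

theorem permVal_le {n : ℕ} (σ : Perm (Fin n)) {m : ℕ} (h : m ≤ n) : permVal n σ m ≤ n := by
  unfold permVal
  split_ifs <;> omega

theorem permVal_succ_self {n : ℕ} (σ : Perm (Fin n)) : permVal n σ (n + 1) = n + 1 := by
  simp [permVal]

theorem permVal_wordInsert {n : ℕ} (j : Fin (n + 1)) (σ : Perm (Fin n)) (m : ℕ) :
    permVal (n + 1) (wordInsert j σ) m =
      if m ≤ j then permVal n σ m else if m = j + 1 then n + 1
      else if m ≤ n + 1 then permVal n σ (m - 1) else n + 2 := by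
  have hj := j.isLt
  split_ifs with h1 h2 h3
  · by_cases h0 : m = 0
    · simp [permVal, h0]
    · have e : (⟨m - 1, by omega⟩ : Fin (n + 1)) = j.succAbove ⟨m - 1, by omega⟩ := by
        rw [Fin.succAbove_of_castSucc_lt _ _ (by rw [Fin.lt_def]; simp; omega)]; rfl
      rw [permVal, permVal, dif_pos (by omega), dif_pos (by omega), e, wordInsert_succAbove]
      rfl
  · have e : (⟨m - 1, by omega⟩ : Fin (n + 1)) = j := Fin.ext (by simp [h2])
    rw [permVal, dif_pos (by omega), e, wordInsert_self]
    rfl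
  · have e : (⟨m - 1, by omega⟩ : Fin (n + 1)) = j.succAbove ⟨m - 1 - 1, by omega⟩ := by
      rw [Fin.succAbove_of_le_castSucc _ _ (by rw [Fin.le_def]; simp; omega)]
      exact Fin.ext (by simp; omega)
    rw [permVal, permVal, dif_pos (by omega), dif_pos (by omega), e, wordInsert_succAbove]
    rfl
  · rw [permVal, dif_neg (by omega), if_neg (by omega)]

theorem leftPeaks_wordInsert_last {n : ℕ} (σ : Perm (Fin n)) :
    leftPeaks (n + 1) (wordInsert (Fin.last n) σ) = (leftPeaks n σ).map Fin.castSuccEmb := by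
  ext a
  refine Fin.lastCases ?_ (fun x => ?_) a
  · simp [leftPeaks, Fin.castSucc_ne_last, permVal_wordInsert]
  · have hx := x.isLt
    rw [← Fin.coe_castSuccEmb, mem_map' Fin.castSuccEmb]
    simp only [leftPeaks, mem_filter, mem_univ, true_and, Fin.coe_castSuccEmb, permVal_wordInsert,
      Fin.val_last, Fin.val_castSucc]
    have h1 := permVal_le σ (m := x + 1) (by omega)
    by_cases h : (x : ℕ) + 2 ≤ n
    · grind
    · have h2 : (x : ℕ) + 2 = n + 1 := by omega
      have := permVal_succ_self σ
      grind

theorem leftPeaks_wordInsert_castSucc {n : ℕ} (k : Fin (n + 1)) (σ : Perm (Fin (n + 1))) :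
    leftPeaks (n + 2) (wordInsert k.castSucc σ) =
      insert k.castSucc
        ((leftPeaks (n + 1) σ \ {k, (finRotate (n + 1)).symm k}).map
          (Fin.succAboveEmb k.castSucc)) := by
  have hk := k.isLt
  ext a
  refine Fin.succAboveCases k.castSucc ?_ (fun x => ?_) a
  · simp only [leftPeaks, mem_filter, mem_univ, true_and, mem_insert, true_or, iff_true,
      permVal_wordInsert, Fin.val_castSucc]
    have h1 := permVal_le σ (m := k) (by omega)
    have h2 := permVal_le σ (m := k + 1) (by omega)
    grind
  · have hx := x.isLt
    rw [mem_insert, or_iff_right (Fin.succAbove_ne _ _), ← Fin.coe_succAboveEmb,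
      mem_map' (Fin.succAboveEmb k.castSucc), Fin.coe_succAboveEmb]
    have hrot : x = (finRotate (n + 1)).symm k ↔
        (x : ℕ) + 1 = k ∨ (x : ℕ) = n ∧ (k : ℕ) = 0 := by
      rw [Equiv.eq_symm_apply, Fin.ext_iff]
      by_cases h : x = Fin.last n
      · subst h
        rw [finRotate_last]
        simp only [Fin.val_last, Fin.val_zero, true_and]
        omega
      · have h' : (x : ℕ) ≠ n := fun h' => h (Fin.ext h')
        rw [coe_finRotate_of_ne_last h]
        omega
    have h1 := permVal_le σ (m := x) (by omega)
    have h2 := permVal_le σ (m := x + 1) (by omega)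
    have h3 := permVal_succ_self σ
    simp only [leftPeaks, mem_filter, mem_univ, true_and, mem_sdiff, mem_insert, mem_singleton,
      hrot, permVal_wordInsert, Fin.val_castSucc, Fin.ext_iff]
    rcases lt_or_ge (x : ℕ) k with h | h
    · rw [Fin.succAbove_of_castSucc_lt _ _ (by rw [Fin.lt_def]; simpa using h)]
      simp only [Fin.val_castSucc]
      have h4 := permVal_le σ (m := x + 2) (by omega)
      grind
    · rw [Fin.succAbove_of_le_castSucc _ _ (by rw [Fin.le_def]; simpa using h)]
      simp only [Fin.val_succ]
      by_cases h' : (x : ℕ) = n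
      · grind
      · have h4 := permVal_le σ (m := x + 2) (by omega)
        grind

theorem sum_lpk_succ (n : ℕ) (G : ℕ → ℕ) :
    ∑ τ : Perm (Fin (n + 1)), G (lpk (n + 1) τ) =
      ∑ σ : Perm (Fin n), (G (lpk n σ) + (2 * lpk n σ * G (lpk n σ) +
        (n - 2 * lpk n σ) * G (lpk n σ + 1))) := by
  rw [← (Equiv.ofBijective _ (wordInsert_bijective n)).sum_comp, Fintype.sum_prod_type_right]
  refine sum_congr rfl fun σ _ => ?_
  rw [Fin.sum_univ_castSucc, add_comm]
  simp only [Equiv.ofBijective_apply, ← card_leftPeaks]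
  congr 1
  · rw [leftPeaks_wordInsert_last, card_map]
  · cases n with
    | zero => simp [leftPeaks]
    | succ n =>
      refine (sum_comp_of_add_indicators (leftPeaks (n + 1) σ) (finRotate (n + 1)).symm
        ?_ _ ?_ G).trans ?_
      · intro k h h'
        obtain ⟨y, rfl⟩ := (finRotate (n + 1)).surjective k
        rw [Equiv.symm_apply_apply] at h'
        simp only [leftPeaks, mem_filter, mem_univ, true_and] at h h'
        by_cases hy : y = Fin.last n
        · subst hy
          have h1 := permVal_le σ (m := n + 1) le_rfl
          have h2 := permVal_succ_self σ
          have h3 := h'.2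
          simp only [Fin.val_last] at h3
          have h4 : permVal (n + 1) σ (n + 2) = n + 2 := h2
          omega
        · rw [coe_finRotate_of_ne_last hy] at h
          exact lt_asymm h.1 h'.2
      · intro k
        rw [leftPeaks_wordInsert_castSucc, card_insert_of_notMem, card_map]
        simp [Fin.succAbove_ne]
      · rw [Fintype.card_fin]

theorem sum_cpk_eq_sum_lpk (n : ℕ) (G : ℕ → ℕ) :
    ∑ τ : Perm (Fin n), G (cpk n τ) = ∑ τ : Perm (Fin n), G (lpk n τ) := by
  induction n generalizing G with
  | zero => simp [cpk, lpk]
  | succ n ih =>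
    rw [sum_cpk_succ, sum_lpk_succ]
    exact ih fun p => G p + (2 * p * G p + (n - 2 * p) * G (p + 1))

/-- For every positive integer `n` and every `k`, the number of
permutations of `{1, …, n}` with exactly `k` cycle peaks equals the number with
exactly `k` left peaks. -/
theorem cpk_equidistributed_lpk (n : ℕ) (hn : 0 < n) (k : ℕ) :
    (Finset.univ.filter (fun τ : Equiv.Perm (Fin n) => cpk n τ = k)).card =
    (Finset.univ.filter (fun τ : Equiv.Perm (Fin n) => lpk n τ = k)).card := by
  rw [card_filter, card_filter]
  exact sum_cpk_eq_sum_lpk n fun p => if p = k then 1 else 0
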